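/- Let M, d ≥ 1 and let U ∈ ℝ^{M×M} be doubly stochastic with nonnegative entries (U𝟙 = 𝟙 and 𝟙ᵀU = 𝟙ᵀ, u_{ij} ≥ 0). Then for every A ∈ ℝ^{d×M} and every real p ≥ 1, ‖AU‖_{p,2}² ≤ ‖A‖_{p,2}². -/

import Mathlib

noncomputable section

open Real Matrix

/-- The ℓ_p norm of a vector in ℝ^d, for a real exponent `p`. -/
def lpNorm {d : ℕ} (p : ℝ) (x : Fin d → ℝ) : ℝ :=
  (∑ i, |x i| ^ p) ^ (1 / p)

/-- The squared `‖·‖_{p,2}` norm of a `d × M` matrix: the sum over columns of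
the squared ℓ_p norms of the columns. -/
def colNormSq {d M : ℕ} (p : ℝ) (A : Matrix (Fin d) (Fin M) ℝ) : ℝ :=
  ∑ j, lpNorm p (fun i => A i j) ^ 2

theorem lpNorm_nonneg' {d : ℕ} (p : ℝ) (x : Fin d → ℝ) : 0 ≤ lpNorm p x := by
  unfold lpNorm
  exact Real.rpow_nonneg (Finset.sum_nonneg fun i _ => Real.rpow_nonneg (abs_nonneg _) _) _

theorem lpNorm_add_le' {d : ℕ} (p : ℝ) (hp : 1 ≤ p) (x y : Fin d → ℝ) :
    lpNorm p (x + y) ≤ lpNorm p x + lpNorm p y := by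
  unfold lpNorm
  exact Real.Lp_add_le Finset.univ x y hp

theorem lpNorm_zero' {d : ℕ} (p : ℝ) (hp : 1 ≤ p) : lpNorm p (0 : Fin d → ℝ) = 0 := by
  have h : p ≠ 0 := by positivity
  simp [lpNorm, Real.zero_rpow h, h]

theorem lpNorm_smul' {d : ℕ} (p : ℝ) (hp : 1 ≤ p) (c : ℝ) (hc : 0 ≤ c) (x : Fin d → ℝ) :
    lpNorm p (c • x) = c * lpNorm p x := by
  have h : p ≠ 0 := by positivity
  unfold lpNorm
  have : ∀ i, |(c • x) i| ^ p = c ^ p * |x i| ^ p := fun i => by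
    rw [Pi.smul_apply, smul_eq_mul, abs_mul, abs_of_nonneg hc,
      Real.mul_rpow hc (abs_nonneg _)]
  simp_rw [this]
  rw [← Finset.mul_sum, Real.mul_rpow (Real.rpow_nonneg hc _)
    (Finset.sum_nonneg fun i _ => Real.rpow_nonneg (abs_nonneg _) _),
    ← Real.rpow_mul hc, mul_one_div_cancel h, Real.rpow_one]

/-- non-expansiveness of multiplication by a doubly stochastic
matrix with nonnegative entries in the `‖·‖_{p,2}` norm:
`‖AU‖_{p,2}² ≤ ‖A‖_{p,2}²`. -/
theorem stmt4 (M d : ℕ) (hM : 1 ≤ M) (hd : 1 ≤ d)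
    (U : Matrix (Fin M) (Fin M) ℝ)
    (hnonneg : ∀ i j, 0 ≤ U i j)
    (hrow : ∀ i, ∑ j, U i j = 1) (hcol : ∀ j, ∑ i, U i j = 1)
    (A : Matrix (Fin d) (Fin M) ℝ) (p : ℝ) (hp : 1 ≤ p) :
    colNormSq p (A * U) ≤ colNormSq p A := by
  have key : ∀ j, lpNorm p (fun i => (A * U) i j) ^ 2 ≤
      ∑ k, U k j * lpNorm p (fun i => A i k) ^ 2 := by
    intro j
    have e : (fun i => (A * U) i j) = ∑ k, U k j • (fun i => A i k) := by
      ext i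
      simp [Matrix.mul_apply, Finset.sum_apply, mul_comm]
    have h1 : lpNorm p (fun i => (A * U) i j) ≤ ∑ k, U k j * lpNorm p (fun i => A i k) := by
      rw [e]
      refine (Finset.le_sum_of_subadditive (lpNorm p) (lpNorm_zero' p hp).le
        (lpNorm_add_le' p hp) _ _).trans (le_of_eq ?_)
      exact Finset.sum_congr rfl fun k _ => lpNorm_smul' p hp _ (hnonneg k j) _
    exact (pow_le_pow_left₀ (lpNorm_nonneg' _ _) h1 2).trans
      (Real.pow_arith_mean_le_arith_mean_pow Finset.univ (fun k => U k j) _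
        (fun k _ => hnonneg k j) (hcol j) (fun k _ => lpNorm_nonneg' _ _) 2)
  unfold colNormSq
  refine (Finset.sum_le_sum fun j _ => key j).trans (le_of_eq ?_)
  rw [Finset.sum_comm]
  refine Finset.sum_congr rfl fun k _ => ?_
  rw [← Finset.sum_mul, hrow, one_mul]
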